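/- (Multi-group decodability.) Let A_1, …, A_N ∈ ℂ^{n_t×T} be the weight matrices of a linear STBC and let c : {1,…,N} → {1,…,g} assign each index to one of g groups. Suppose that for every pair i, j with c(i) ≠ c(j), the pair (A_i, A_j) satisfies the symmetrized trace conditions. Then for every number of receive antennas n_r and every channel matrix H ∈ ℂ^{n_r×n_t}, letting h_k^eq = ṽec(H·A_k) ∈ ℝ^{2 n_r T} be the columns of the equivalent channel matrix and r_1,…,r_N their (unnormalized) Gram–Schmidt orthogonalization, one has ⟨r_i, h_j^eq⟩ = 0 whenever c(i) ≠ c(j). Hence every entry R_{ij} of the R-factor of the QR decomposition of the equivalent channel matrix with i, j in different groups vanishes, i.e. the code is g-group sphere decodable, and this holds independently of H and n_r. -/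

import Mathlib

open Matrix Complex
open scoped RealInnerProductSpace ComplexConjugate

instance finWFLT (N : ℕ) : WellFoundedLT (Fin N) := inferInstance

/-- Realified (column-stacked) vectorization of a complex matrix. -/
noncomputable def tvec {m n : ℕ} (X : Matrix (Fin m) (Fin n) ℂ) :
    EuclideanSpace ℝ (Fin n × Fin m × Fin 2) :=
  WithLp.toLp 2 fun p => if p.2.2 = 0 then (X p.2.1 p.1).re else (X p.2.1 p.1).im

/-- The symmetrized trace conditions on a pair of complex `n_t × T` matrices. -/
def SymTraceCond {nt T : ℕ} (A B : Matrix (Fin nt) (Fin T) ℂ) : Prop :=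
  (∀ q p : Fin nt, q ≤ p →
    ∑ l : Fin T, (A q l * conj (B p l) + A p l * conj (B q l)).re = 0) ∧
  (∀ q p : Fin nt, q < p →
    ∑ l : Fin T, (Complex.I * (A q l * conj (B p l) - A p l * conj (B q l))).re = 0)

/-- The Euclidean inner product of realified vectorizations is the real part of the trace form. -/
theorem inner_tvec {m n : ℕ} (X Y : Matrix (Fin m) (Fin n) ℂ) :
    ⟪tvec X, tvec Y⟫ = (X * Yᴴ).trace.re := by
  simp only [tvec, PiLp.inner_apply, Fintype.sum_prod_type, Fin.sum_univ_two, Matrix.trace,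
    Matrix.diag_apply, Matrix.mul_apply, Matrix.conjTranspose_apply, Complex.re_sum]
  rw [Finset.sum_comm]
  refine Finset.sum_congr rfl fun i _ => Finset.sum_congr rfl fun j _ => ?_
  simp
  ring

/-- The symmetrized trace conditions say that `A * Bᴴ` is skew-Hermitian. -/
theorem SymTraceCond.conjTranspose_mul_eq_neg {nt T : ℕ} {A B : Matrix (Fin nt) (Fin T) ℂ}
    (h : SymTraceCond A B) : (A * Bᴴ)ᴴ = -(A * Bᴴ) := by
  have key : ∀ q p : Fin nt, q ≤ p →
      ((A * Bᴴ) q p).re + ((A * Bᴴ) p q).re = 0 ∧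
        ((A * Bᴴ) q p).im = ((A * Bᴴ) p q).im := by
    intro q p hqp
    constructor
    · have h₁ := h.1 q p hqp
      simpa only [Matrix.mul_apply, Matrix.conjTranspose_apply, Complex.re_sum, Complex.add_re,
        Finset.sum_add_distrib, starRingEnd_apply] using h₁
    · rcases hqp.eq_or_lt with rfl | hlt
      · rfl
      have h₂ := h.2 q p hlt
      simp only [Complex.I_mul_re, Complex.sub_im, Finset.sum_neg_distrib,
        Finset.sum_sub_distrib, starRingEnd_apply] at h₂
      simp only [Matrix.mul_apply, Matrix.conjTranspose_apply, Complex.im_sum]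
      linarith
  ext p q
  rw [Matrix.conjTranspose_apply, Matrix.neg_apply]
  rcases le_total q p with hqp | hpq
  · obtain ⟨h₁, h₂⟩ := key q p hqp
    apply Complex.ext
    · simp only [Complex.star_def, Complex.conj_re, Complex.neg_re]; linarith
    · simp only [Complex.star_def, Complex.conj_im, Complex.neg_im]; linarith
  · obtain ⟨h₁, h₂⟩ := key p q hpq
    apply Complex.ext
    · simp only [Complex.star_def, Complex.conj_re, Complex.neg_re]; linarith
    · simp only [Complex.star_def, Complex.conj_im, Complex.neg_im]; linarith

/-- Under the symmetrized trace conditions, left multiplication by any matrix yields orthogonal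
realified vectorizations. -/
theorem SymTraceCond.inner_tvec_mul_eq_zero {nr nt T : ℕ} {A B : Matrix (Fin nt) (Fin T) ℂ}
    (h : SymTraceCond A B) (H : Matrix (Fin nr) (Fin nt) ℂ) :
    ⟪tvec (H * A), tvec (H * B)⟫ = 0 := by
  have hM : H * A * (H * B)ᴴ = H * (A * Bᴴ) * Hᴴ := by
    simp only [Matrix.conjTranspose_mul, Matrix.mul_assoc]
  have hskew : (H * (A * Bᴴ) * Hᴴ)ᴴ = -(H * (A * Bᴴ) * Hᴴ) := by
    rw [Matrix.conjTranspose_mul, Matrix.conjTranspose_mul, h.conjTranspose_mul_eq_neg,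
      Matrix.conjTranspose_conjTranspose, Matrix.neg_mul, Matrix.mul_neg, ← Matrix.mul_assoc]
  have htrace := congrArg (fun M => (Matrix.trace M).re) hskew
  simp only [Matrix.trace_conjTranspose, Matrix.trace_neg, Complex.star_def, Complex.conj_re,
    Complex.neg_re] at htrace
  rw [inner_tvec, hM]
  linarith

section GramSchmidt

variable {𝕜 E ι κ : Type*} [RCLike 𝕜] [NormedAddCommGroup E] [InnerProductSpace 𝕜 E]

/-- A vector in the span of one group is orthogonal to all vectors of the other groups. -/
theorem inner_eq_zero_of_mem_span_fiber {f : ι → E} {c : ι → κ}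
    (hf : ∀ i j, c i ≠ c j → inner 𝕜 (f i) (f j) = 0) {i j : ι} (hij : c i ≠ c j) {x : E}
    (hx : x ∈ Submodule.span 𝕜 (f '' {k | c k = c i})) : inner 𝕜 x (f j) = 0 := by
  induction hx using Submodule.span_induction with
  | mem x hx =>
    obtain ⟨k, hk, rfl⟩ := hx
    exact hf k j (by rwa [show c k = c i from hk])
  | zero => exact inner_zero_left _
  | add x y _ _ hx hy => rw [inner_add_left, hx, hy, add_zero]
  | smul a x _ hx => rw [inner_smul_left, hx, mul_zero]

/-- If distinct groups of vectors are mutually orthogonal, then the Gram–Schmidt process stays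
within the span of each group. -/
theorem gramSchmidt_mem_span_fiber [LinearOrder ι] [LocallyFiniteOrderBot ι]
    [WellFoundedLT ι] {f : ι → E} {c : ι → κ}
    (hf : ∀ i j, c i ≠ c j → inner 𝕜 (f i) (f j) = 0) (i : ι) :
    InnerProductSpace.gramSchmidt 𝕜 f i ∈ Submodule.span 𝕜 (f '' {k | c k = c i}) := by
  induction i using WellFoundedLT.induction with
  | ind i ih =>
    rw [InnerProductSpace.gramSchmidt_def]
    refine Submodule.sub_mem _ (Submodule.subset_span ⟨i, rfl, rfl⟩)
      (Submodule.sum_mem _ fun k hk => ?_)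
    have hmem := ih k (Finset.mem_Iio.mp hk)
    rw [Submodule.starProjection_singleton]
    by_cases hki : c k = c i
    · rw [hki] at hmem
      exact Submodule.smul_mem _ _ hmem
    · rw [inner_eq_zero_of_mem_span_fiber hf hki hmem, zero_div, zero_smul]
      exact Submodule.zero_mem _

end GramSchmidt

/-- multi-group decodability: if the symmetrized trace conditions hold for
every pair of weight matrices in different groups, then for every `n_r` and `H`, the
Gram–Schmidt vectors `r_i` of the columns `h_k^eq = ṽec(H·A_k)` of the equivalent channel
matrix satisfy `⟨r_i, h_j^eq⟩ = 0` whenever `c(i) ≠ c(j)`: the `R`-factor is block diagonal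
according to the partition (the code is `g`-group sphere decodable), independently of
`H` and `n_r`. -/
theorem stmt13 (nt T N g : ℕ)
    (A : Fin N → Matrix (Fin nt) (Fin T) ℂ) (c : Fin N → Fin g)
    (h : ∀ i j : Fin N, c i ≠ c j → SymTraceCond (A i) (A j)) :
    ∀ (nr : ℕ) (H : Matrix (Fin nr) (Fin nt) ℂ) (i j : Fin N), c i ≠ c j →
      ⟪InnerProductSpace.gramSchmidt ℝ (fun k => tvec (H * A k)) i, tvec (H * A j)⟫ = 0 := by
  intro nr H i j hij
  have hf : ∀ k l, c k ≠ c l → ⟪tvec (H * A k), tvec (H * A l)⟫ = 0 :=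
    fun k l hkl => (h k l hkl).inner_tvec_mul_eq_zero H
  exact inner_eq_zero_of_mem_span_fiber hf hij (gramSchmidt_mem_span_fiber hf i)
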